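/- Let 1<p₁,p₂<∞, 0<α<2n, α/n < 1/p₁ + 1/p₂ < 2, and 1/q = 1/p₁ + 1/p₂ − α/n with 1<q<∞. Let b be a real-valued BMO function with ‖b‖_{BMO} = 1 such that for some ε>0 there is a sequence of cubes {Q_j} with |Q_j| → ∞ as j → ∞ and ⨍_{Q_j}|b − b_{Q_j}| ≥ ε for every j. Then there exist sequences {f_j} bounded in L^{p₁}(ℝⁿ) and {g_j} bounded in L^{p₂}(ℝⁿ) and a constant c>0 such that ‖[b,I_α]₁(f_j,g_j) − [b,I_α]₁(f_k,g_k)‖_{L^q} ≥ c for all j ≠ k; in particular [b,I_α]₁ is not compact from L^{p₁} × L^{p₂} to L^q. -/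

import Mathlib

open MeasureTheory Set Filter
open scoped ENNReal BigOperators Topology

noncomputable section

/-- Euclidean space `ℝⁿ`. -/
abbrev Rn (n : ℕ) : Type := EuclideanSpace ℝ (Fin n)

/-- The closed axis-parallel cube with center `c` and side length `d`. -/
def cube (n : ℕ) (c : Rn n) (d : ℝ) : Set (Rn n) :=
  {x | ∀ i : Fin n, |x i - c i| ≤ d / 2}

/-- The average `b_Q` of `b` over the cube with center `c` and side length `d`. -/
def cubeAvg (n : ℕ) (b : Rn n → ℝ) (c : Rn n) (d : ℝ) : ℝ :=
  ⨍ x in cube n c d, b x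

/-- The mean oscillation `⨍_Q |b - b_Q|` of `b` over a cube. -/
def osc (n : ℕ) (b : Rn n → ℝ) (c : Rn n) (d : ℝ) : ℝ :=
  ⨍ x in cube n c d, |b x - cubeAvg n b c d|

/-- The BMO seminorm: supremum of mean oscillations over all axis-parallel cubes. -/
def bmoNorm (n : ℕ) (b : Rn n → ℝ) : ℝ :=
  ⨆ cd : Rn n × {d : ℝ // 0 < d}, osc n b cd.1 cd.2.1

/-- `b ∈ CMO`: `b` belongs to the closure of `C_c^∞` in the BMO seminorm. -/
def MemCMO (n : ℕ) (b : Rn n → ℝ) : Prop :=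
  ∀ ε : ℝ, 0 < ε → ∃ φ : Rn n → ℝ, ContDiff ℝ (⊤ : ℕ∞) φ ∧ HasCompactSupport φ ∧
    bmoNorm n (b - φ) < ε

/-- The conjugate exponent `p' = p/(p-1)`. -/
def conjExp (p : ℝ) : ℝ := p / (p - 1)

/-- The Muckenhoupt class `A_p`. -/
def MuckenhouptAp (n : ℕ) (p : ℝ) (w : Rn n → ℝ) : Prop :=
  (∀ x, 0 ≤ w x) ∧ LocallyIntegrable w volume ∧
  ∃ C : ℝ, ∀ (c : Rn n) (d : ℝ), 0 < d →
    (⨍ x in cube n c d, w x) *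
      (⨍ x in cube n c d, w x ^ (1 - conjExp p)) ^ (p / conjExp p) ≤ C

/-- The `A_p` characteristic constant `[w]_{A_p}`. -/
def apConst (n : ℕ) (p : ℝ) (w : Rn n → ℝ) : ℝ :=
  ⨆ cd : Rn n × {d : ℝ // 0 < d},
    (⨍ x in cube n cd.1 cd.2.1, w x) *
      (⨍ x in cube n cd.1 cd.2.1, w x ^ (1 - conjExp p)) ^ (p / conjExp p)

/-- The bilinear class `A_{P,q}` for `P = (p₁,p₂)`. -/
def MuckenhouptAPq (n : ℕ) (p₁ p₂ q : ℝ) (w₁ w₂ : Rn n → ℝ) : Prop :=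
  ∃ C : ℝ, ∀ (c : Rn n) (d : ℝ), 0 < d →
    (⨍ x in cube n c d, (w₁ x * w₂ x) ^ q) *
      (⨍ x in cube n c d, w₁ x ^ (-(conjExp p₁))) ^ (q / conjExp p₁) *
      (⨍ x in cube n c d, w₂ x ^ (-(conjExp p₂))) ^ (q / conjExp p₂) ≤ C

/-- The kernel of the bilinear fractional integral `I_α`. -/
def fracKernel (n : ℕ) (α : ℝ) (x y z : Rn n) : ℝ :=
  (‖x - y‖ ^ 2 + ‖x - z‖ ^ 2) ^ (-((n : ℝ) - α / 2))

/-- The bilinear fractional integral operator `I_α`. -/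
def Iop (n : ℕ) (α : ℝ) (f g : Rn n → ℝ) (x : Rn n) : ℝ :=
  ∫ y, ∫ z, fracKernel n α x y z * (f y * g z)

/-- The first commutator `[b, I_α]₁(f,g) = I_α(bf, g) - b · I_α(f,g)`. -/
def commI (n : ℕ) (α : ℝ) (b f g : Rn n → ℝ) : Rn n → ℝ :=
  fun x => Iop n α (fun y => b y * f y) g x - b x * Iop n α f g x

/-- The weighted Lᵖ norm `(∫ |f|^p w)^{1/p}` (with value in `ℝ≥0∞`). -/
def wNorm (n : ℕ) (p : ℝ) (w : Rn n → ℝ) (f : Rn n → ℝ) : ℝ≥0∞ :=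
  (∫⁻ x, ENNReal.ofReal (|f x| ^ p * w x)) ^ (1 / p)

/-- A bilinear operator `T` is compact from `L^{p₁}(w₁) × L^{p₂}(w₂)` to `L^q(μ)` when the
image of the product of unit balls is precompact in `L^q(μ)`; equivalently (by completeness),
every sequence in the image of the unit balls admits a subsequence which is Cauchy for the
`L^q(μ)` norm. -/
def BilinCompact (n : ℕ) (p₁ p₂ q : ℝ) (w₁ w₂ μ : Rn n → ℝ)
    (T : (Rn n → ℝ) → (Rn n → ℝ) → Rn n → ℝ) : Prop :=
  ∀ F G : ℕ → Rn n → ℝ,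
    (∀ j, wNorm n p₁ w₁ (F j) ≤ 1) → (∀ j, wNorm n p₂ w₂ (G j) ≤ 1) →
    ∃ φ : ℕ → ℕ, StrictMono φ ∧
      ∀ ε : ℝ, 0 < ε → ∃ N : ℕ, ∀ j ≥ N, ∀ k ≥ N,
        wNorm n q μ (fun x => T (F (φ j)) (G (φ j)) x - T (F (φ k)) (G (φ k)) x)
          < ENNReal.ofReal ε

/-- The smoothly truncated kernel `K^δ` with implicit constant `A`. -/
def IsTruncKernel (n : ℕ) (α δ A : ℝ) (K : Rn n → Rn n → Rn n → ℝ) : Prop :=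
  ContDiff ℝ 1 (fun pt : Rn n × Rn n × Rn n => K pt.1 pt.2.1 pt.2.2) ∧
  (∀ x y z, 2 * δ < max ‖x - y‖ ‖x - z‖ → K x y z = fracKernel n α x y z) ∧
  (∀ x y z, max ‖x - y‖ ‖x - z‖ < δ → K x y z = 0) ∧
  (∀ x y z : Rn n, |K x y z| ≤ A * (‖x - y‖ + ‖x - z‖) ^ (-(2 * (n : ℝ) - α))) ∧
  (∀ x y z : Rn n,
    ‖fderiv ℝ (fun pt : Rn n × Rn n × Rn n => K pt.1 pt.2.1 pt.2.2) (x, y, z)‖ ≤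
      A * (‖x - y‖ + ‖x - z‖) ^ (-(2 * (n : ℝ) - α - 1)))

/-- The bilinear operator with kernel `K`. -/
def IopK (n : ℕ) (K : Rn n → Rn n → Rn n → ℝ) (f g : Rn n → ℝ) (x : Rn n) : ℝ :=
  ∫ y, ∫ z, K x y z * (f y * g z)

/-- The first commutator of the truncated operator. -/
def commIK (n : ℕ) (K : Rn n → Rn n → Rn n → ℝ) (b f g : Rn n → ℝ) : Rn n → ℝ :=
  fun x => IopK n K (fun y => b y * f y) g x - b x * IopK n K f g x

/-- The bilinear fractional maximal function `M_α`. -/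
def Mmax (n : ℕ) (α : ℝ) (f g : Rn n → ℝ) (x : Rn n) : ℝ :=
  ⨆ cd : {cd : Rn n × ℝ // 0 < cd.2 ∧ x ∈ cube n cd.1 cd.2},
    ((cd : Rn n × ℝ).2 ^ n) ^ (α / n) *
      ((⨍ y in cube n (cd : Rn n × ℝ).1 (cd : Rn n × ℝ).2, |f y|) *
        (⨍ z in cube n (cd : Rn n × ℝ).1 (cd : Rn n × ℝ).2, |g z|))

/-- The test function `f_j` associated to the cube with center `c`, side `d` and symbol `b`:
`f_j = |Q|^{-1/p₁} (sgn(b - b_Q) - c₀) χ_Q` where `c₀ = ⨍_Q sgn(b - b_Q)`. -/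
def testF (n : ℕ) (p₁ : ℝ) (b : Rn n → ℝ) (c : Rn n) (d : ℝ) : Rn n → ℝ :=
  indicator (cube n c d) fun y =>
    (d ^ n) ^ (-(1 / p₁)) *
      (Real.sign (b y - cubeAvg n b c d) -
        ⨍ z in cube n c d, Real.sign (b z - cubeAvg n b c d))

/-- The test function `g_j = |Q|^{-1/p₂} χ_Q` associated to the cube with center `c`, side `d`. -/
def testG (n : ℕ) (p₂ : ℝ) (c : Rn n) (d : ℝ) : Rn n → ℝ :=
  indicator (cube n c d) fun _ => (d ^ n) ^ (-(1 / p₂))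

end

section helpers

lemma cube_eq (n : ℕ) (c : Rn n) (d : ℝ) :
    cube n c d = (fun x : Rn n => WithLp.ofLp x) ⁻¹'
      (Set.Icc (fun i => c i - d / 2) (fun i => c i + d / 2)) := by
  ext x
  simp only [cube, Set.mem_ofPred_eq, Set.mem_preimage, Set.mem_Icc, Pi.le_def, abs_le,
    ← forall_and]
  refine forall_congr' fun i => ?_
  constructor <;> rintro ⟨h1, h2⟩ <;> constructor <;> linarith

lemma cube_meas (n : ℕ) (c : Rn n) (d : ℝ) : MeasurableSet (cube n c d) := by
  rw [cube_eq]
  exact (PiLp.volume_preserving_ofLp (Fin n)).measurable measurableSet_Icc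

lemma cube_vol (n : ℕ) (c : Rn n) (d : ℝ) (hd : 0 < d) :
    volume (cube n c d) = ENNReal.ofReal (d ^ n) := by
  rw [cube_eq, (PiLp.volume_preserving_ofLp (Fin n)).measure_preimage
    measurableSet_Icc.nullMeasurableSet, Real.volume_Icc_pi]
  simp [ENNReal.ofReal_pow hd.le]

lemma cube_compact (n : ℕ) (c : Rn n) (d : ℝ) : IsCompact (cube n c d) := by
  have : cube n c d = (PiLp.homeomorph 2 (fun _ : Fin n => ℝ)) ⁻¹'
      (Set.Icc (fun i => c i - d / 2) (fun i => c i + d / 2)) := cube_eq n c d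
  rw [this]
  exact (PiLp.homeomorph 2 (fun _ : Fin n => ℝ)).isCompact_preimage.mpr isCompact_Icc

lemma exists_median {X : Type*} [MeasurableSpace X] (μ : Measure X) [IsFiniteMeasure μ]
    (b : X → ℝ) (hb : Measurable b) (h0 : μ univ ≠ 0) :
    ∃ m : ℝ, μ univ / 2 ≤ μ {x | b x ≤ m} ∧ μ univ / 2 ≤ μ {x | m ≤ b x} := by
  set ν := μ.map b with hν
  have huniv : ν univ = μ univ := by rw [hν, Measure.map_apply hb MeasurableSet.univ]; simp
  have hhalf : μ univ / 2 < μ univ := ENNReal.half_lt_self h0 (measure_ne_top _ _)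
  have hpos : 0 < μ univ / 2 := ENNReal.half_pos h0
  set S := {t : ℝ | μ univ / 2 ≤ ν (Iic t)} with hS
  have h1 := tendsto_measure_Iic_atTop ν
  have h2 := tendsto_measure_Ici_atBot ν
  rw [huniv] at h1 h2
  have hne : S.Nonempty := by
    obtain ⟨t, ht⟩ := (h1.eventually (lt_mem_nhds hhalf)).exists
    exact ⟨t, ht.le⟩
  have hbd : BddBelow S := by
    obtain ⟨t, ht⟩ := (h2.eventually (lt_mem_nhds hhalf)).exists
    refine ⟨t, fun s hs => ?_⟩
    by_contra hlt
    push Not at hlt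
    have hdis : Disjoint (Iic s) (Ici t) := by
      rw [Set.disjoint_left]
      intro y hy1 hy2
      exact absurd (le_trans (Set.mem_Ici.mp hy2) (Set.mem_Iic.mp hy1)) (not_le.mpr hlt)
    have hle : ν (Iic s) + ν (Ici t) ≤ μ univ := by
      rw [← measure_union hdis measurableSet_Ici, ← huniv]
      exact measure_mono (subset_univ _)
    have hs' : μ univ / 2 ≤ ν (Iic s) := hs
    have := ENNReal.add_lt_add_of_le_of_lt (by finiteness) hs' ht
    rw [ENNReal.add_halves] at this
    exact absurd (this.trans_le hle) (lt_irrefl _)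
  obtain ⟨u, hu1, hu2, hu3⟩ := exists_seq_strictAnti_tendsto (sInf S)
  obtain ⟨v, hv1, hv2, hv3⟩ := exists_seq_strictMono_tendsto (sInf S)
  refine ⟨sInf S, ?_, ?_⟩
  · have hIic : Iic (sInf S) = ⋂ k, Iic (u k) := by
      ext y
      simp only [Set.mem_Iic, Set.mem_iInter]
      exact ⟨fun h k => h.trans (hu2 k).le, fun h => ge_of_tendsto' hu3 h⟩
    have ht : Tendsto (fun k => ν (Iic (u k))) atTop (𝓝 (ν (Iic (sInf S)))) := by
      rw [hIic]
      exact tendsto_measure_iInter_atTop (fun k => measurableSet_Iic.nullMeasurableSet)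
        (fun i j hij => Iic_subset_Iic.mpr (hu1.antitone hij)) ⟨0, measure_ne_top _ _⟩
    have : μ univ / 2 ≤ ν (Iic (sInf S)) := by
      refine ge_of_tendsto' ht fun k => ?_
      obtain ⟨s, hs, hsu⟩ := exists_lt_of_csInf_lt hne (hu2 k)
      exact le_trans hs (measure_mono (Iic_subset_Iic.mpr hsu.le))
    rwa [hν, Measure.map_apply hb measurableSet_Iic] at this
  · have hIci : Ici (sInf S) = ⋂ k, Ioi (v k) := by
      ext y
      simp only [Set.mem_Ici, Set.mem_iInter, Set.mem_Ioi]
      exact ⟨fun h k => (hv2 k).trans_le h, fun h => le_of_tendsto' hv3 fun k => (h k).le⟩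
    have ht : Tendsto (fun k => ν (Ioi (v k))) atTop (𝓝 (ν (Ici (sInf S)))) := by
      rw [hIci]
      exact tendsto_measure_iInter_atTop (fun k => measurableSet_Ioi.nullMeasurableSet)
        (fun i j hij => Ioi_subset_Ioi (hv1.monotone hij)) ⟨0, measure_ne_top _ _⟩
    have : μ univ / 2 ≤ ν (Ici (sInf S)) := by
      refine ge_of_tendsto' ht fun k => ?_
      have hk : ν (Iic (v k)) < μ univ / 2 := by
        by_contra hcon
        push Not at hcon
        exact absurd (csInf_le hbd hcon) (not_le.mpr (hv2 k))
      have hsum : ν (Iic (v k)) + ν (Ioi (v k)) = μ univ := by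
        rw [← huniv, ← compl_Iic, measure_add_measure_compl measurableSet_Iic]
      by_contra hcon
      push Not at hcon
      have := ENNReal.add_lt_add hk hcon
      rw [hsum, ENNReal.add_halves] at this
      exact lt_irrefl _ this
    rwa [hν, Measure.map_apply hb measurableSet_Ici] at this

lemma kernel_bounds (n : ℕ) (hn : 0 < n) (α : ℝ) (hα₂ : α < 2 * n) (c c' : Rn n) (d : ℝ)
    (hd : 0 < d) (hc : ∀ i, c' i = c i + 2 * d) (x y z : Rn n) (hx : x ∈ cube n c' d)
    (hy : y ∈ cube n c d) (hz : z ∈ cube n c d) :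
    (18 * n * d ^ 2) ^ (-((n : ℝ) - α / 2)) ≤ fracKernel n α x y z ∧
      fracKernel n α x y z ≤ (d ^ 2) ^ (-((n : ℝ) - α / 2)) := by
  have hκ : -((n : ℝ) - α / 2) ≤ 0 := by linarith
  have key : ∀ w ∈ cube n c d, d ^ 2 ≤ ‖x - w‖ ^ 2 ∧ ‖x - w‖ ^ 2 ≤ 9 * n * d ^ 2 := by
    intro w hw
    have hb : ∀ i, d ≤ x i - w i ∧ x i - w i ≤ 3 * d := by
      intro i
      have h1 := abs_le.mp (hx i)
      have h2 := abs_le.mp (hw i)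
      rw [hc i] at h1
      constructor <;> linarith [h1.1, h1.2, h2.1, h2.2]
    rw [EuclideanSpace.norm_sq_eq]
    have hterm : ∀ i, d ^ 2 ≤ ‖(x - w) i‖ ^ 2 ∧ ‖(x - w) i‖ ^ 2 ≤ 9 * d ^ 2 := by
      intro i
      have := hb i
      simp only [PiLp.sub_apply, Real.norm_eq_abs, sq_abs]
      constructor <;> nlinarith
    constructor
    · calc d ^ 2 ≤ ‖(x - w) ⟨0, hn⟩‖ ^ 2 := (hterm _).1
        _ ≤ _ := Finset.single_le_sum (f := fun i => ‖(x - w) i‖ ^ 2)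
            (fun i _ => by positivity) (Finset.mem_univ _)
    · calc _ ≤ ∑ i : Fin n, 9 * d ^ 2 := Finset.sum_le_sum fun i _ => (hterm i).2
        _ = _ := by simp; ring
  have h1 := key y hy
  have h2 := key z hz
  have hd2 : 0 < d ^ 2 := by positivity
  unfold fracKernel
  constructor
  · exact Real.rpow_le_rpow_of_nonpos (by linarith) (by linarith) hκ
  · exact Real.rpow_le_rpow_of_nonpos hd2 (by linarith) hκ

lemma kernel_meas (n : ℕ) (α : ℝ) :
    Measurable (fun p : (Rn n × Rn n) × Rn n => fracKernel n α p.1.1 p.1.2 p.2) := by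
  unfold fracKernel
  fun_prop

lemma Iop_meas (n : ℕ) (α : ℝ) (f g : Rn n → ℝ) (hf : Measurable f) (hg : Measurable g) :
    Measurable (Iop n α f g) := by
  have h : StronglyMeasurable (fun p : (Rn n × Rn n) × Rn n =>
      fracKernel n α p.1.1 p.1.2 p.2 * (f p.1.2 * g p.2)) := by
    have := kernel_meas n α
    exact Measurable.stronglyMeasurable (by fun_prop)
  have h2 := h.integral_prod_right' (ν := (volume : Measure (Rn n)))
  have h3 := h2.integral_prod_right' (ν := (volume : Measure (Rn n)))
  exact h3.measurable

lemma commI_meas (n : ℕ) (α : ℝ) (b f g : Rn n → ℝ) (hb : Measurable b)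
    (hf : Measurable f) (hg : Measurable g) : Measurable (commI n α b f g) :=
  (Iop_meas n α _ g (hb.mul hf) hg).sub (hb.mul (Iop_meas n α f g hf hg))

lemma commI_smul (n : ℕ) (α s : ℝ) (b f g : Rn n → ℝ) (x : Rn n) :
    commI n α b (fun y => s * f y) g x = s * commI n α b f g x := by
  have : ∀ (f : Rn n → ℝ), Iop n α (fun y => s * f y) g x = s * Iop n α f g x := by
    intro f
    unfold Iop
    rw [← integral_const_mul]
    congr 1; ext y
    rw [← integral_const_mul]
    congr 1; ext z
    ring
  unfold commI
  rw [this, ← sub_eq_zero]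
  have h2 : (fun y => b y * (s * f y)) = fun y => s * (b y * f y) := by ext y; ring
  rw [h2, this]; ring

lemma T_lower (n : ℕ) (hn : 0 < n) (α : ℝ) (hα₂ : α < 2 * n) (c c' : Rn n) (d : ℝ)
    (hd : 0 < d) (hc : ∀ i, c' i = c i + 2 * d) (b : Rn n → ℝ)
    (hbl : LocallyIntegrable b volume) (A : Set (Rn n)) (hA : MeasurableSet A)
    (hAQ : A ⊆ cube n c d) (x : Rn n) (hx : x ∈ cube n c' d) (m s a e δ : ℝ)
    (ha : 0 ≤ a) (he : 0 ≤ e) (hs : ∀ y ∈ A, |b y - m| ≤ s * (b y - b x))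
    (hδ : δ ≤ ∫ y in A, |b y - m|) :
    a * ((18 * n * d ^ 2) ^ (-((n : ℝ) - α / 2)) * e * d ^ n) * δ ≤
      commI n α b (A.indicator fun _ => s * a) ((cube n c d).indicator fun _ => e) x := by
  set Q := cube n c d with hQ
  have hQm : MeasurableSet Q := cube_meas n c d
  have hQv : volume Q = ENNReal.ofReal (d ^ n) := cube_vol n c d hd
  have hQfin : volume Q ≠ ⊤ := by rw [hQv]; exact ENNReal.ofReal_ne_top
  have hQr : volume.real Q = d ^ n := by
    rw [measureReal_def, hQv, ENNReal.toReal_ofReal (by positivity)]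
  set k₀ := (18 * n * d ^ 2) ^ (-((n : ℝ) - α / 2)) with hk₀
  set k₁ := (d ^ 2) ^ (-((n : ℝ) - α / 2)) with hk₁
  have hk₀0 : 0 ≤ k₀ := by positivity
  have hK : ∀ y ∈ Q, ∀ z ∈ Q, k₀ ≤ fracKernel n α x y z ∧ fracKernel n α x y z ≤ k₁ :=
    fun y hy z hz => kernel_bounds n hn α hα₂ c c' d hd hc x y z hx hy hz
  have hKm := kernel_meas n α
  set H : Rn n → ℝ := fun y => ∫ z in Q, fracKernel n α x y z * e with hH
  have hHm : StronglyMeasurable H := by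
    have h : StronglyMeasurable (fun p : Rn n × Rn n => fracKernel n α x p.1 p.2 * e) := by
      have : Measurable (fun p : Rn n × Rn n => fracKernel n α x p.1 p.2) :=
        hKm.comp (g := fun p : (Rn n × Rn n) × Rn n => fracKernel n α p.1.1 p.1.2 p.2)
          (f := fun p : Rn n × Rn n => ((x, p.1), p.2)) (by fun_prop)
      exact Measurable.stronglyMeasurable (by fun_prop)
    exact h.integral_prod_right' (ν := volume.restrict Q)
  have hHb : ∀ y ∈ Q, k₀ * e * d ^ n ≤ H y ∧ H y ≤ k₁ * e * d ^ n := by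
    intro y hy
    have hmz : Measurable (fun z => fracKernel n α x y z * e) := by
      have : Measurable (fun z => fracKernel n α x y z) :=
        hKm.comp (g := fun p : (Rn n × Rn n) × Rn n => fracKernel n α p.1.1 p.1.2 p.2)
          (f := fun z : Rn n => ((x, y), z)) (by fun_prop)
      fun_prop
    have hint : IntegrableOn (fun z => fracKernel n α x y z * e) Q := by
      refine Measure.integrableOn_of_bounded (M := k₁ * e) hQfin hmz.aestronglyMeasurable ?_
      refine (ae_restrict_iff' hQm).mpr (ae_of_all _ fun z hz => ?_)
      have := hK y hy z hz
      rw [Real.norm_of_nonneg (mul_nonneg (hk₀0.trans this.1) he)]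
      exact mul_le_mul_of_nonneg_right this.2 he
    have hci : ∀ r : ℝ, ∫ z in Q, r = r * d ^ n := by
      intro r; rw [setIntegral_const, hQr, smul_eq_mul, mul_comm]
    have hcI : ∀ r : ℝ, IntegrableOn (fun _ : Rn n => r) Q := fun r => integrableOn_const hQfin
    constructor
    · rw [← hci]
      exact setIntegral_mono_on (hcI _) hint hQm fun z hz =>
        mul_le_mul_of_nonneg_right (hK y hy z hz).1 he
    · rw [← hci]
      exact setIntegral_mono_on hint (hcI _) hQm fun z hz =>
        mul_le_mul_of_nonneg_right (hK y hy z hz).2 he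
  have hη : 0 ≤ k₀ * e * d ^ n := by positivity
  have hIop : ∀ f : Rn n → ℝ, Iop n α f (Q.indicator fun _ => e) x = ∫ y, f y * H y := by
    intro f
    unfold Iop
    congr 1; ext y
    rw [hH]
    simp only
    rw [← integral_indicator hQm, ← integral_const_mul]
    congr 1; ext z
    by_cases hz : z ∈ Q
    · simp [hz]; ring
    · simp [hz]
  have hAfin : volume A ≠ ⊤ := ne_top_of_le_ne_top hQfin (measure_mono hAQ)
  have hbA : IntegrableOn b A :=
    (hbl.integrableOn_isCompact (cube_compact n c d)).mono_set hAQ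
  have hHA : ∀ᵐ y ∂(volume.restrict A), ‖H y‖ ≤ k₁ * e * d ^ n := by
    refine (ae_restrict_iff' hA).mpr (ae_of_all _ fun y hy => ?_)
    have := hHb y (hAQ hy)
    rw [Real.norm_of_nonneg (hη.trans this.1)]
    exact this.2
  have hbH : IntegrableOn (fun y => b y * H y) A := by
    exact Integrable.mul_bdd hbA hHm.aestronglyMeasurable hHA
  have hHI : IntegrableOn H A :=
    Measure.integrableOn_of_bounded hAfin hHm.aestronglyMeasurable hHA
  have e1 : ∫ y, b y * A.indicator (fun _ => s * a) y * H y
      = s * a * ∫ y in A, b y * H y := by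
    rw [← integral_indicator hA, ← integral_const_mul]
    congr 1; ext y
    by_cases hy : y ∈ A
    · simp [hy]; ring
    · simp [hy]
  have e2 : ∫ y, A.indicator (fun _ => s * a) y * H y = s * a * ∫ y in A, H y := by
    rw [← integral_indicator hA, ← integral_const_mul]
    congr 1; ext y
    by_cases hy : y ∈ A
    · simp [hy]
    · simp [hy]
  have e3 : commI n α b (A.indicator fun _ => s * a) (Q.indicator fun _ => e) x
      = ∫ y in A, a * (s * (b y - b x)) * H y := by
    unfold commI
    rw [hIop, hIop, e1, e2]
    have : ∀ y, a * (s * (b y - b x)) * H y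
        = s * a * (b y * H y) - (b x * (s * a)) * H y := fun y => by ring
    simp_rw [this]
    rw [integral_sub (hbH.const_mul _) (hHI.const_mul _), integral_const_mul,
      integral_const_mul]
    ring
  rw [e3]
  have hbm : IntegrableOn (fun y => |b y - m|) A :=
    (hbA.sub (integrableOn_const hAfin)).abs
  calc a * (k₀ * e * d ^ n) * δ ≤ a * (k₀ * e * d ^ n) * ∫ y in A, |b y - m| :=
        mul_le_mul_of_nonneg_left hδ (mul_nonneg ha hη)
    _ = ∫ y in A, a * (k₀ * e * d ^ n) * |b y - m| := (integral_const_mul _ _).symm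
    _ ≤ _ := by
        refine setIntegral_mono_on (hbm.const_mul _) ?_ hA fun y hy => ?_
        · have : ∀ y, a * (s * (b y - b x)) * H y
            = s * a * (b y * H y) - (b x * (s * a)) * H y := fun y => by ring
          simp_rw [this]
          exact (hbH.const_mul _).sub (hHI.const_mul _)
        · have h1 := hs y hy
          have h2 := (hHb y (hAQ hy)).1
          have h3 : |b y - m| * (k₀ * e * d ^ n) ≤ (s * (b y - b x)) * H y :=
            mul_le_mul h1 h2 hη ((abs_nonneg _).trans h1)
          have := mul_le_mul_of_nonneg_left h3 ha
          linarith

lemma osc_median (n : ℕ) (b : Rn n → ℝ) (hbl : LocallyIntegrable b volume) (c : Rn n) (d ε : ℝ)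
    (hd : 0 < d) (hosc : ε ≤ osc n b c d) (m : ℝ) :
    ε / 2 * d ^ n ≤ ∫ y in cube n c d, |b y - m| := by
  set Q := cube n c d with hQ
  have hQv : volume Q = ENNReal.ofReal (d ^ n) := cube_vol n c d hd
  have hQfin : volume Q ≠ ⊤ := by rw [hQv]; exact ENNReal.ofReal_ne_top
  have hQr : volume.real Q = d ^ n := by
    rw [measureReal_def, hQv, ENNReal.toReal_ofReal (by positivity)]
  have hb : IntegrableOn b Q := hbl.integrableOn_isCompact (cube_compact n c d)
  have hcI : ∀ r : ℝ, IntegrableOn (fun _ : Rn n => r) Q := fun r => integrableOn_const hQfin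
  have hdn : 0 < d ^ n := by positivity
  set β := cubeAvg n b c d with hβ
  have hβ' : β * d ^ n = ∫ y in Q, b y := by
    rw [hβ, cubeAvg, ← hQ, setAverage_eq, hQr, smul_eq_mul]; field_simp
  have ho : osc n b c d * d ^ n = ∫ y in Q, |b y - β| := by
    rw [osc, ← hβ, ← hQ, setAverage_eq, hQr, smul_eq_mul]; field_simp
  have hci : ∀ r : ℝ, ∫ z in Q, r = r * d ^ n := by
    intro r; rw [setIntegral_const, hQr, smul_eq_mul, mul_comm]
  have h1 : |m - β| * d ^ n ≤ ∫ y in Q, |b y - m| := by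
    have : (m - β) * d ^ n = - ∫ y in Q, (b y - m) := by
      rw [integral_sub hb (hcI m), hci, ← hβ']; ring
    rw [← abs_of_pos hdn, ← abs_mul, this, abs_neg]
    exact abs_integral_le_integral_abs
  have h2 : ∫ y in Q, |b y - β| ≤ ∫ y in Q, (|b y - m| + |m - β|) := by
    refine integral_mono (hb.sub (hcI β)).abs ((hb.sub (hcI m)).abs.add (hcI _)) fun y => ?_
    exact abs_sub_le _ _ _
  have hbm : IntegrableOn (fun y => |b y - m|) Q := (hb.sub (hcI m)).abs
  rw [integral_add hbm (hcI _), hci, ← ho] at h2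
  have := mul_le_mul_of_nonneg_right hosc hdn.le
  linarith

lemma wNorm_ind (n : ℕ) (p : ℝ) (hp : 1 < p) (c : Rn n) (d s : ℝ) (hd : 0 < d) (hs : |s| ≤ 1)
    (A : Set (Rn n)) (hAm : MeasurableSet A) (hA : A ⊆ cube n c d) :
    wNorm n p (fun _ => 1) (A.indicator fun _ => s * (d ^ n) ^ (-(1 / p))) ≤ 1 := by
  have hdn : 0 < d ^ n := by positivity
  have hp0 : 0 < p := by linarith
  unfold wNorm
  refine ENNReal.rpow_le_one ?_ (by positivity)
  calc ∫⁻ x, ENNReal.ofReal (|A.indicator (fun _ => s * (d ^ n) ^ (-(1 / p))) x| ^ p * 1)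
      ≤ ∫⁻ x, A.indicator (fun _ => ENNReal.ofReal ((d ^ n)⁻¹)) x := by
        refine lintegral_mono fun x => ?_
        by_cases hx : x ∈ A
        · simp only [hx, Set.indicator_of_mem, mul_one]
          refine ENNReal.ofReal_le_ofReal ?_
          have h0 : 0 ≤ (d ^ n) ^ (-(1 / p)) := by positivity
          calc |s * (d ^ n) ^ (-(1 / p))| ^ p ≤ ((d ^ n) ^ (-(1 / p))) ^ p := by
                refine Real.rpow_le_rpow (abs_nonneg _) ?_ hp0.le
                rw [abs_mul, abs_of_nonneg h0]
                exact mul_le_of_le_one_left h0 hs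
            _ = (d ^ n)⁻¹ := by
                rw [← Real.rpow_mul hdn.le, ← Real.rpow_neg_one]
                congr 1; field_simp
        · simp [hx, Real.zero_rpow hp0.ne']
    _ = ENNReal.ofReal ((d ^ n)⁻¹) * volume A := by rw [lintegral_indicator_const hAm]
    _ ≤ ENNReal.ofReal ((d ^ n)⁻¹) * ENNReal.ofReal (d ^ n) := by
        rw [← cube_vol n c d hd]; gcongr
    _ = 1 := by
        rw [← ENNReal.ofReal_mul (by positivity), inv_mul_cancel₀ hdn.ne', ENNReal.ofReal_one]

lemma cube_test (n : ℕ) (hn : 0 < n) (p₁ p₂ q α : ℝ)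
    (hp₁ : 1 < p₁) (hp₂ : 1 < p₂) (hα₂ : α < 2 * n)
    (hq : 1 / q = 1 / p₁ + 1 / p₂ - α / n)
    (b : Rn n → ℝ) (hbm : Measurable b) (hbl : LocallyIntegrable b volume)
    (ε : ℝ) (c : Rn n) (d : ℝ) (hd : 0 < d) (hosc : ε ≤ osc n b c d) :
    ∃ (F G : Rn n → ℝ) (E : Set (Rn n)), Measurable F ∧ Measurable G ∧
      wNorm n p₁ (fun _ => 1) F ≤ 1 ∧ wNorm n p₂ (fun _ => 1) G ≤ 1 ∧
      MeasurableSet E ∧ ENNReal.ofReal (d ^ n) / 2 ≤ volume E ∧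
      ∀ x ∈ E, (18 * n : ℝ) ^ (-((n : ℝ) - α / 2)) * (ε / 4) * (d ^ n) ^ (-(1 / q)) ≤
        commI n α b F G x := by
  set Q := cube n c d with hQ
  have hn' : (0 : ℝ) < n := by exact_mod_cast hn
  have hQm : MeasurableSet Q := cube_meas n c d
  set c' : Rn n := WithLp.toLp 2 (fun i => c i + 2 * d) with hc'
  have hc : ∀ i, c' i = c i + 2 * d := fun i => rfl
  set Q' := cube n c' d with hQ'
  have hQ'm : MeasurableSet Q' := cube_meas n c' d
  have hQ'v : volume Q' = ENNReal.ofReal (d ^ n) := cube_vol n c' d hd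
  have hdn : 0 < d ^ n := by positivity
  haveI : IsFiniteMeasure (volume.restrict Q') :=
    ⟨by rw [Measure.restrict_apply_univ, hQ'v]; exact ENNReal.ofReal_lt_top⟩
  obtain ⟨m, hm1, hm2⟩ := exists_median (volume.restrict Q') b hbm (by
    rw [Measure.restrict_apply_univ, hQ'v]; simpa using hdn)
  have hmle : MeasurableSet {x | b x ≤ m} := measurableSet_le hbm measurable_const
  have hmge : MeasurableSet {x | m ≤ b x} := measurableSet_le measurable_const hbm
  rw [Measure.restrict_apply_univ, hQ'v, Measure.restrict_apply hmle] at hm1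
  rw [Measure.restrict_apply_univ, hQ'v, Measure.restrict_apply hmge] at hm2
  have hconst : (18 * n : ℝ) ^ (-((n : ℝ) - α / 2)) * (ε / 4) * (d ^ n) ^ (-(1 / q)) =
      (d ^ n) ^ (-(1 / p₁)) * ((18 * n * d ^ 2) ^ (-((n : ℝ) - α / 2)) *
        (d ^ n) ^ (-(1 / p₂)) * d ^ n) * (ε / 4 * d ^ n) := by
    have h1 : (18 * n * d ^ 2 : ℝ) ^ (-((n : ℝ) - α / 2)) =
        (18 * n : ℝ) ^ (-((n : ℝ) - α / 2)) * (d ^ n) ^ (-(2 - α / n)) := by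
      rw [Real.mul_rpow (by positivity) (by positivity)]
      congr 1
      rw [← Real.rpow_natCast, ← Real.rpow_natCast, ← Real.rpow_mul hd.le, ← Real.rpow_mul hd.le]
      congr 1
      push_cast
      field_simp
    have h2 : (d ^ n) ^ (-(1 / q)) = (d ^ n) ^ (-(1 / p₁)) * (d ^ n) ^ (-(2 - α / n)) *
        (d ^ n) ^ (-(1 / p₂)) * d ^ n * d ^ n := by
      have h3 : -(1 / q) = -(1 / p₁) + -(2 - α / n) + -(1 / p₂) + 1 + 1 := by rw [hq]; ring
      rw [h3, Real.rpow_add hdn, Real.rpow_add hdn, Real.rpow_add hdn, Real.rpow_add hdn,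
        Real.rpow_one]
    rw [h1, h2]; ring
  have hGm : Measurable (Q.indicator fun _ => (d ^ n) ^ (-(1 / p₂))) :=
    measurable_const.indicator hQm
  have hGn : wNorm n p₂ (fun _ => 1) (Q.indicator fun _ => (d ^ n) ^ (-(1 / p₂))) ≤ 1 := by
    have := wNorm_ind n p₂ hp₂ c d 1 hd (by simp) Q hQm subset_rfl
    simpa using this
  have hsplit : ∫ y in Q, |b y - m| =
      (∫ y in Q ∩ {y | m ≤ b y}, |b y - m|) + ∫ y in Q \ {y | m ≤ b y}, |b y - m| := by
    refine (integral_inter_add_sdiff hmge ?_).symm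
    have hQv : volume Q = ENNReal.ofReal (d ^ n) := cube_vol n c d hd
    have hQfin : volume Q ≠ ⊤ := by rw [hQv]; exact ENNReal.ofReal_ne_top
    exact ((hbl.integrableOn_isCompact (cube_compact n c d)).sub (integrableOn_const hQfin)).abs
  have htot := osc_median n b hbl c d ε hd hosc m
  rw [← hQ, hsplit] at htot
  have hor : ε / 4 * d ^ n ≤ (∫ y in Q ∩ {y | m ≤ b y}, |b y - m|) ∨
      ε / 4 * d ^ n ≤ ∫ y in Q \ {y | m ≤ b y}, |b y - m| := by
    by_contra hcon
    push Not at hcon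
    linarith [hcon.1, hcon.2]
  rcases hor with hor | hor
  · have hAm : MeasurableSet (Q ∩ {y | m ≤ b y}) := hQm.inter hmge
    refine ⟨_, _, {x | b x ≤ m} ∩ Q', measurable_const.indicator hAm, hGm,
      wNorm_ind n p₁ hp₁ c d 1 hd (by simp) _ hAm inter_subset_left, hGn, hmle.inter hQ'm,
      hm1, fun x hx => ?_⟩
    rw [hconst]
    refine T_lower n hn α hα₂ c c' d hd hc b hbl _ hAm inter_subset_left x hx.2 m _ _ _ _
      (by positivity) (by positivity) (fun y hy => ?_) hor
    have h1 : m ≤ b y := hy.2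
    have h2 : b x ≤ m := hx.1
    rw [abs_of_nonneg (by linarith)]
    linarith
  · have hAm : MeasurableSet (Q \ {y | m ≤ b y}) := hQm.diff hmge
    refine ⟨_, _, {x | m ≤ b x} ∩ Q', measurable_const.indicator hAm, hGm,
      wNorm_ind n p₁ hp₁ c d (-1) hd (by simp) _ hAm sdiff_subset, hGn, hmge.inter hQ'm,
      hm2, fun x hx => ?_⟩
    rw [hconst]
    refine T_lower n hn α hα₂ c c' d hd hc b hbl _ hAm sdiff_subset x hx.2 m _ _ _ _
      (by positivity) (by positivity) (fun y hy => ?_) hor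
    have h1 : b y < m := not_le.mp hy.2
    have h2 : m ≤ b x := hx.1
    rw [abs_of_nonpos (by linarith)]
    linarith

/-- Soft separation lemma. -/
lemma separation (n : ℕ) (q : ℝ) (hq : 1 < q) (c₀ : ℝ) (hc₀ : 0 < c₀)
    (D : ℕ → ℝ) (hD : ∀ j, 0 < D j) (hDt : Tendsto D atTop atTop)
    (T : ℕ → Rn n → ℝ) (hT : ∀ j, Measurable (T j)) (E : ℕ → Set (Rn n))
    (hE : ∀ j, MeasurableSet (E j)) (hEv : ∀ j, ENNReal.ofReal (D j) / 2 ≤ volume (E j))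
    (hTE : ∀ j, ∀ x ∈ E j, c₀ * D j ^ (-(1 / q)) ≤ T j x)
    (j : ℕ) (hfin : wNorm n q (fun _ => 1) (T j) ≠ ⊤) :
    ∀ᶠ k in atTop, ENNReal.ofReal (((c₀ / 2) ^ q / 4) ^ (1 / q)) ≤
      wNorm n q (fun _ => 1) (fun x => T j x - T k x) := by
  have hq0 : 0 < q := by linarith
  have hfin' : ∫⁻ x, ENNReal.ofReal (|T j x| ^ q) ≠ ⊤ := by
    intro h
    apply hfin
    unfold wNorm
    simp only [mul_one]
    rw [h, ENNReal.top_rpow_of_pos (by positivity)]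
  set s : ℕ → ℝ := fun k => (c₀ / 2) ^ q * (D k)⁻¹ with hs
  have hs0 : ∀ k, 0 < s k := fun k => by have := hD k; positivity
  have hst : Tendsto s atTop (𝓝 0) := by
    have := (tendsto_inv_atTop_zero.comp hDt).const_mul ((c₀ / 2) ^ q)
    simpa using this
  have hlim : Tendsto (fun k => ∫⁻ x, min (ENNReal.ofReal (|T j x| ^ q)) (ENNReal.ofReal (s k)))
      atTop (𝓝 (∫⁻ _x : Rn n, (0 : ℝ≥0∞))) := by
    refine tendsto_lintegral_of_dominated_convergence (fun x => ENNReal.ofReal (|T j x| ^ q))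
      (fun k => ?_) (fun k => ae_of_all _ fun x => min_le_left _ _) hfin' (ae_of_all _ fun x => ?_)
    · have := hT j
      have h2 : Measurable fun x => |T j x| := this.abs
      fun_prop
    · refine tendsto_of_tendsto_of_tendsto_of_le_of_le tendsto_const_nhds
        ?_ (fun k => zero_le) (fun k => min_le_right _ _)
      simpa using ENNReal.tendsto_ofReal hst
  rw [lintegral_zero] at hlim
  have hsmall : (0 : ℝ≥0∞) < ENNReal.ofReal ((c₀ / 2) ^ q / 4) := by
    rw [ENNReal.ofReal_pos]; positivity
  filter_upwards [hlim.eventually (gt_mem_nhds hsmall)] with k hk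
  have hDk := hD k
  set B := {x | s k ≤ |T j x| ^ q} with hB
  have hBm : MeasurableSet B := by
    have h2 : Measurable fun x => |T j x| := (hT j).abs
    exact measurableSet_le measurable_const (by fun_prop)
  -- measure of B
  have hBv : ENNReal.ofReal (s k) * volume B ≤ ENNReal.ofReal ((c₀ / 2) ^ q / 4) := by
    refine le_trans ?_ hk.le
    rw [← lintegral_indicator_const hBm]
    refine lintegral_mono fun x => ?_
    by_cases hx : x ∈ B
    · simp only [hx, Set.indicator_of_mem]
      exact le_min (ENNReal.ofReal_le_ofReal hx) le_rfl
    · simp [hx]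
  have hBv' : volume B ≤ ENNReal.ofReal (D k / 4) := by
    have hne : ENNReal.ofReal (s k) ≠ 0 := by simpa using hs0 k
    rw [← ENNReal.mul_le_mul_iff_right hne ENNReal.ofReal_ne_top]
    refine hBv.trans (le_of_eq ?_)
    rw [← ENNReal.ofReal_mul (hs0 k).le]
    congr 1
    simp only [hs]; field_simp
  have hEB : ENNReal.ofReal (D k / 4) ≤ volume (E k \ B) := by
    have h1 : ENNReal.ofReal (D k / 2) ≤ volume (E k) := by
      rw [ENNReal.ofReal_div_of_pos (by norm_num)]
      simpa using hEv k
    calc ENNReal.ofReal (D k / 4) = ENNReal.ofReal (D k / 2) - ENNReal.ofReal (D k / 4) := by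
          rw [← ENNReal.ofReal_sub _ (by positivity)]
          congr 1; ring
      _ ≤ volume (E k) - volume B := tsub_le_tsub h1 hBv'
      _ ≤ volume (E k \ B) := le_measure_sdiff
  have hpt : ∀ x ∈ E k \ B, s k ≤ |T j x - T k x| ^ q := by
    intro x hx
    have h1 := hTE k x hx.1
    have h2 : |T j x| ^ q < s k := not_le.mp hx.2
    have hsr : s k = (c₀ / 2 * D k ^ (-(1 / q))) ^ q := by
      rw [Real.mul_rpow (by positivity) (by positivity), ← Real.rpow_mul hDk.le]
      simp only [hs]
      congr 1
      rw [← Real.rpow_neg_one]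
      congr 1; field_simp
    rw [hsr] at h2 ⊢
    have h3 : |T j x| < c₀ / 2 * D k ^ (-(1 / q)) :=
      (Real.rpow_lt_rpow_iff (abs_nonneg _) (by positivity) hq0).mp h2
    refine Real.rpow_le_rpow (by positivity) ?_ hq0.le
    rw [abs_sub_comm]
    have := le_abs_self (T j x)
    refine le_trans ?_ (le_abs_self _)
    linarith
  unfold wNorm
  rw [← ENNReal.ofReal_rpow_of_nonneg (by positivity) (by positivity)]
  refine ENNReal.rpow_le_rpow ?_ (by positivity)
  calc ENNReal.ofReal ((c₀ / 2) ^ q / 4)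
      = ENNReal.ofReal (s k) * ENNReal.ofReal (D k / 4) := by
        rw [← ENNReal.ofReal_mul (hs0 k).le]
        congr 1
        simp only [hs]; field_simp
    _ ≤ ENNReal.ofReal (s k) * volume (E k \ B) := by gcongr
    _ = ∫⁻ x, (E k \ B).indicator (fun _ => ENNReal.ofReal (s k)) x := by
        rw [lintegral_indicator_const ((hE k).diff hBm)]
    _ ≤ _ := by
        refine lintegral_mono fun x => ?_
        by_cases hx : x ∈ E k \ B
        · rw [Set.indicator_of_mem hx, mul_one]
          exact ENNReal.ofReal_le_ofReal (hpt x hx)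
        · rw [Set.indicator_of_notMem hx]; exact zero_le

lemma wNorm_symm (n : ℕ) (q : ℝ) (f g : Rn n → ℝ) :
    wNorm n q (fun _ => 1) (fun x => f x - g x) = wNorm n q (fun _ => 1) (fun x => g x - f x) := by
  unfold wNorm
  simp only [abs_sub_comm]

lemma wNorm_smul_top (n : ℕ) (q : ℝ) (hq : 1 < q) (r : ℝ) (hr : r ≠ 0) (f : Rn n → ℝ)
    (h : wNorm n q (fun _ => 1) f = ⊤) : wNorm n q (fun _ => 1) (fun x => r * f x) = ⊤ := by
  have hq0 : 0 < q := by linarith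
  unfold wNorm at h ⊢
  have h' := (ENNReal.rpow_eq_top_iff_of_pos (by positivity)).mp h
  rw [ENNReal.rpow_eq_top_iff_of_pos (by positivity)]
  have : ∀ x, ENNReal.ofReal (|r * f x| ^ q * 1) =
      ENNReal.ofReal (|r| ^ q) * ENNReal.ofReal (|f x| ^ q * 1) := by
    intro x
    rw [← ENNReal.ofReal_mul (by positivity), abs_mul, Real.mul_rpow (by positivity) (by positivity)]
    congr 1; ring
  simp_rw [this]
  rw [lintegral_const_mul' _ _ ENNReal.ofReal_ne_top, h', ENNReal.mul_top]
  have : 0 < |r| ^ q := Real.rpow_pos_of_pos (abs_pos.mpr hr) _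
  simpa using this

lemma wNorm_smul_le (n : ℕ) (p : ℝ) (hp : 1 < p) (r : ℝ) (hr : |r| ≤ 1) (f : Rn n → ℝ) :
    wNorm n p (fun _ => 1) (fun x => r * f x) ≤ wNorm n p (fun _ => 1) f := by
  unfold wNorm
  refine ENNReal.rpow_le_rpow (lintegral_mono fun x => ENNReal.ofReal_le_ofReal ?_) (by positivity)
  simp only [mul_one, abs_mul]
  exact Real.rpow_le_rpow (by positivity) (mul_le_of_le_one_left (abs_nonneg _) hr) (by linarith)

lemma core (n : ℕ) (hn : 0 < n) (p₁ p₂ q α : ℝ)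
    (hp₁ : 1 < p₁) (hp₂ : 1 < p₂) (hα₂ : α < 2 * n)
    (hq : 1 / q = 1 / p₁ + 1 / p₂ - α / n) (hq' : 1 < q)
    (b : Rn n → ℝ) (hbm : Measurable b) (hb : LocallyIntegrable b volume)
    (ε : ℝ) (hε : 0 < ε)
    (cc : ℕ → Rn n) (d : ℕ → ℝ) (hd : ∀ j, 0 < d j)
    (hsize : Tendsto (fun j => d j ^ n) atTop atTop)
    (hosc : ∀ j, ε ≤ osc n b (cc j) (d j)) :
    ∃ (F G : ℕ → Rn n → ℝ) (c : ℝ), 0 < c ∧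
      (∀ j, wNorm n p₁ (fun _ => 1) (F j) ≤ 1) ∧
      (∀ j, wNorm n p₂ (fun _ => 1) (G j) ≤ 1) ∧
      (∀ j k : ℕ, j ≠ k →
        ENNReal.ofReal c ≤
          wNorm n q (fun _ => 1)
            (fun x => commI n α b (F j) (G j) x - commI n α b (F k) (G k) x)) := by
  have hn' : (0 : ℝ) < n := by exact_mod_cast hn
  choose F G E hF hG hFn hGn hE hEv hT using fun j =>
    cube_test n hn p₁ p₂ q α hp₁ hp₂ hα₂ hq b hbm hb ε (cc j) (d j) (hd j) (hosc j)
  set c₀ := (18 * n : ℝ) ^ (-((n : ℝ) - α / 2)) * (ε / 4) with hc₀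
  have hc₀p : 0 < c₀ := by positivity
  by_cases hinf : ∃ j, wNorm n q (fun _ => 1) (commI n α b (F j) (G j)) = ⊤
  · obtain ⟨j₀, hj₀⟩ := hinf
    refine ⟨fun i x => (1 / ((i : ℝ) + 1)) * F j₀ x, fun _ => G j₀, 1, one_pos, fun i => ?_,
      fun i => hGn j₀, fun i k hik => ?_⟩
    · refine (wNorm_smul_le n p₁ hp₁ _ ?_ _).trans (hFn j₀)
      rw [abs_of_nonneg (by positivity), div_le_one (by positivity)]
      linarith [(Nat.cast_nonneg i : (0 : ℝ) ≤ i)]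
    · simp only [commI_smul, ← sub_mul]
      rw [wNorm_smul_top n q hq' _ ?_ _ hj₀]
      · exact le_top
      · rw [sub_ne_zero]
        intro h
        apply hik
        have h1 : ((i : ℝ) + 1) ≠ 0 := by positivity
        have h2 : ((k : ℝ) + 1) ≠ 0 := by positivity
        field_simp at h
        have h3 : (i : ℝ) = k := by linarith
        exact_mod_cast h3
  · push Not at hinf
    have hsep := separation n q hq' c₀ hc₀p (fun j => d j ^ n) (fun j => pow_pos (hd j) n) hsize
      (fun j => commI n α b (F j) (G j)) (fun j => commI_meas n α b _ _ hbm (hF j) (hG j))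
      E hE hEv hT
    set c := ((c₀ / 2) ^ q / 4) ^ (1 / q) with hc
    obtain ⟨φ, -, hφ⟩ := exists_seq_of_forall_finset_exists (fun _ : ℕ => True)
      (fun j k => ENNReal.ofReal c ≤ wNorm n q (fun _ => 1)
        (fun x => commI n α b (F j) (G j) x - commI n α b (F k) (G k) x)) (by
        intro S _
        have : ∀ᶠ k in atTop, ∀ j ∈ S, ENNReal.ofReal c ≤ wNorm n q (fun _ => 1)
            (fun x => commI n α b (F j) (G j) x - commI n α b (F k) (G k) x) := by
          rw [Filter.eventually_all_finset]
          exact fun j _ => hsep j (hinf j)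
        obtain ⟨k, hk⟩ := this.exists
        exact ⟨k, trivial, hk⟩)
    refine ⟨fun j => F (φ j), fun j => G (φ j), c, by positivity, fun j => hFn _, fun j => hGn _,
      fun j k hjk => ?_⟩
    rcases lt_or_gt_of_ne hjk with h | h
    · exact hφ j k h
    · rw [wNorm_symm]; exact hφ k j h

end helpers

/-- If `b` is a real-valued BMO function with `‖b‖_{BMO} = 1` whose mean
oscillations stay above `ε` on a sequence of cubes with `|Q_j| → ∞`, then there are bounded
sequences in `L^{p₁}` and `L^{p₂}` whose images under `[b,I_α]₁` are uniformly separated in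
`L^q`; in particular `[b,I_α]₁` is not compact from `L^{p₁} × L^{p₂}` to `L^q`. -/
theorem statement18 (n : ℕ) (hn : 0 < n) (p₁ p₂ q α : ℝ)
    (hp₁ : 1 < p₁) (hp₂ : 1 < p₂)
    (hα₀ : 0 < α) (hα₂ : α < 2 * n)
    (hαp : α / n < 1 / p₁ + 1 / p₂) (hsum : 1 / p₁ + 1 / p₂ < 2)
    (hq : 1 / q = 1 / p₁ + 1 / p₂ - α / n) (hq' : 1 < q)
    (b : Rn n → ℝ) (hb : LocallyIntegrable b volume) (hbmo : bmoNorm n b = 1)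
    (ε : ℝ) (hε : 0 < ε)
    (cc : ℕ → Rn n) (d : ℕ → ℝ) (hd : ∀ j, 0 < d j)
    (hsize : Tendsto (fun j => d j ^ n) atTop atTop)
    (hosc : ∀ j, ε ≤ osc n b (cc j) (d j)) :
    ∃ (F G : ℕ → Rn n → ℝ) (c : ℝ), 0 < c ∧
      (∃ M : ℝ, ∀ j, wNorm n p₁ (fun _ => 1) (F j) ≤ ENNReal.ofReal M) ∧
      (∃ M : ℝ, ∀ j, wNorm n p₂ (fun _ => 1) (G j) ≤ ENNReal.ofReal M) ∧
      (∀ j k : ℕ, j ≠ k →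
        ENNReal.ofReal c ≤
          wNorm n q (fun _ => 1)
            (fun x => commI n α b (F j) (G j) x - commI n α b (F k) (G k) x)) ∧
      ¬ BilinCompact n p₁ p₂ q (fun _ => 1) (fun _ => 1) (fun _ => 1) (commI n α b) := by
  have hbae : AEStronglyMeasurable b volume := hb.aestronglyMeasurable
  set b' := hbae.mk b with hb'
  have hbm : Measurable b' := hbae.stronglyMeasurable_mk.measurable
  have hbb : b =ᵐ[volume] b' := hbae.ae_eq_mk
  have hbl : LocallyIntegrable b' volume := hb.congr hbb
  have havg : ∀ c d, cubeAvg n b c d = cubeAvg n b' c d := by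
    intro c d
    unfold cubeAvg
    rw [setAverage_eq, setAverage_eq, integral_congr_ae (ae_restrict_of_ae hbb)]
  have hosc' : ∀ c d, osc n b c d = osc n b' c d := by
    intro c d
    unfold osc
    rw [setAverage_eq, setAverage_eq, havg]
    congr 1
    refine integral_congr_ae (ae_restrict_of_ae ?_)
    filter_upwards [hbb] with x hx
    rw [hx]
  have hcomm : ∀ f g, commI n α b f g =ᵐ[volume] commI n α b' f g := by
    intro f g
    filter_upwards [hbb] with x hx
    unfold commI
    rw [hx]
    congr 1
    unfold Iop
    refine integral_congr_ae ?_
    filter_upwards [hbb] with y hy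
    simp only [hy]
  obtain ⟨F, G, c, hc, hF, hG, hsep⟩ := core n hn p₁ p₂ q α hp₁ hp₂ hα₂ hq hq' b' hbm hbl ε hε
    cc d hd hsize (fun j => (hosc' _ _) ▸ hosc j)
  have hsep' : ∀ j k : ℕ, j ≠ k → ENNReal.ofReal c ≤ wNorm n q (fun _ => 1)
      (fun x => commI n α b (F j) (G j) x - commI n α b (F k) (G k) x) := by
    intro j k hjk
    refine (hsep j k hjk).trans (le_of_eq ?_)
    unfold wNorm
    congr 1
    refine lintegral_congr_ae ?_
    filter_upwards [hcomm (F j) (G j), hcomm (F k) (G k)] with x h1 h2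
    rw [h1, h2]
  refine ⟨F, G, c, hc, ⟨1, fun j => by simpa using hF j⟩, ⟨1, fun j => by simpa using hG j⟩,
    hsep', fun hcomp => ?_⟩
  obtain ⟨φ, hφ, hcau⟩ := hcomp F G hF hG
  obtain ⟨N, hN⟩ := hcau c hc
  have h1 := hN N le_rfl (N + 1) (Nat.le_succ N)
  have h2 := hsep' (φ N) (φ (N + 1)) (hφ (Nat.lt_succ_self N)).ne
  exact absurd (h2.trans_lt h1) (lt_irrefl _)
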